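/- Set h = ln q. Let c_1, c_2, c'_1, c'_2 be complex numbers with c_1 + c_2 = c'_1 + c'_2, and suppose that [z - c_1][z - c_2] = [z - c'_1][z - c'_2] for every complex number z. Then there exists an integer k such that either (c'_1 = c_1 + iπk/h and c'_2 = c_2 - iπk/h) or (c'_1 = c_2 + iπk/h and c'_2 = c_1 - iπk/h). -/

import Mathlib

open Finset

noncomputable section

/-- `q^z` for a complex exponent `z`, where `q > 0`. -/
def qpow (q : ℝ) (z : ℂ) : ℂ := Complex.exp (z * Real.log q)

/-- The `q`-number `[z] = (q^z - q^{-z})/(q - q⁻¹)` for complex `z`. -/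
def qnum (q : ℝ) (z : ℂ) : ℂ := (qpow q z - qpow q (-z)) / ((q : ℂ) - (q : ℂ)⁻¹)

theorem ofReal_sub_inv_ne_zero {q : ℝ} (hq : 0 < q) (hq1 : q ≠ 1) :
    (q : ℂ) - (q : ℂ)⁻¹ ≠ 0 := by
  intro h
  have hr : q - q⁻¹ = 0 := by exact_mod_cast h
  have hmul : q * q⁻¹ = 1 := mul_inv_cancel₀ hq.ne'
  rw [← sub_eq_zero.mp hr] at hmul
  exact hq1 (by nlinarith)

/-- The zeros of `z ↦ [z]` lie in `(iπ/h) ℤ`, where `h = ln q`. -/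
theorem exists_int_of_qnum_eq_zero {q : ℝ} (hq : 0 < q) (hq1 : q ≠ 1) {z : ℂ}
    (hz : qnum q z = 0) : ∃ k : ℤ, z = Real.pi * Complex.I * k / Real.log q := by
  have hlog : (Real.log q : ℂ) ≠ 0 := by
    exact_mod_cast Real.log_ne_zero_of_pos_of_ne_one hq hq1
  have hexp := sub_eq_zero.mp
    ((div_eq_zero_iff.mp hz).resolve_right (ofReal_sub_inv_ne_zero hq hq1))
  obtain ⟨k, hk⟩ := Complex.exp_eq_exp_iff_exists_int.mp hexp
  refine ⟨k, (eq_div_iff hlog).mpr ?_⟩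
  linear_combination hk / 2

/-- If `c₁ + c₂ = c'₁ + c'₂` and `[z-c₁][z-c₂] = [z-c'₁][z-c'₂]` for all complex `z`,
then `(c'₁, c'₂)` is obtained from `(c₁, c₂)` (possibly swapped) by shifting by
`iπk/h`, `k ∈ ℤ`, where `h = ln q`. -/
theorem pair_determined_up_to_shift
    (q : ℝ) (hq : 0 < q) (hq1 : q ≠ 1)
    (c₁ c₂ c₁' c₂' : ℂ) (hsum : c₁ + c₂ = c₁' + c₂')
    (hprod : ∀ z : ℂ, qnum q (z - c₁) * qnum q (z - c₂) =
      qnum q (z - c₁') * qnum q (z - c₂')) :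
    ∃ k : ℤ,
      (c₁' = c₁ + Real.pi * Complex.I * k / Real.log q ∧
        c₂' = c₂ - Real.pi * Complex.I * k / Real.log q) ∨
      (c₁' = c₂ + Real.pi * Complex.I * k / Real.log q ∧
        c₂' = c₁ - Real.pi * Complex.I * k / Real.log q) := by
  have hself : qnum q 0 = 0 := by simp [qnum]
  have hzero := hprod c₁'
  rw [sub_self, hself, zero_mul] at hzero
  rcases mul_eq_zero.mp hzero with h | h
  · obtain ⟨k, hk⟩ := exists_int_of_qnum_eq_zero hq hq1 h
    exact ⟨k, Or.inl ⟨by linear_combination hk, by linear_combination -hsum - hk⟩⟩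
  · obtain ⟨k, hk⟩ := exists_int_of_qnum_eq_zero hq hq1 h
    exact ⟨k, Or.inr ⟨by linear_combination hk, by linear_combination -hsum - hk⟩⟩

end
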